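/- There exists a constant C > 0 such that for every effort cost c ∈ (0,1] and every natural number n with n ≥ C/c², and every approval probability q ∈ [0,1], the expected net utility gain from scrutiny is negative: 2 · binom(n−1, ⌊n/2⌋) · q^{⌊n/2⌋} · (1−q)^{⌈n/2⌉−1} − c < 0. Consequently, for any fixed effort cost c > 0, rubber-stamp approval without scrutiny strictly dominates careful scrutiny once the number of auditors exceeds a threshold of order c^{−2}. -/

import Mathlib

theorem two_mul_add_one_mul_centralBinom_sq_le (k : ℕ) :
    (2 * k + 1) * k.centralBinom ^ 2 ≤ 16 ^ k := by
  induction k with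
  | zero => simp
  | succ k ih =>
    have h := Nat.succ_mul_centralBinom_succ k
    refine Nat.le_of_mul_le_mul_left (c := (k + 1) ^ 2) ?_ (by positivity)
    calc (k + 1) ^ 2 * ((2 * (k + 1) + 1) * (k + 1).centralBinom ^ 2)
        = (2 * k + 3) * ((k + 1) * (k + 1).centralBinom) ^ 2 := by ring
      _ = 4 * ((2 * k + 1) * (2 * k + 3)) * ((2 * k + 1) * k.centralBinom ^ 2) := by
        rw [h]; ring
      _ ≤ 4 * (4 * (k + 1) ^ 2) * 16 ^ k := by
        have hk : (2 * k + 1) * (2 * k + 3) ≤ 4 * (k + 1) ^ 2 := by nlinarith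
        gcongr 4 * ?_ * ?_
      _ = (k + 1) ^ 2 * 16 ^ (k + 1) := by ring

theorem two_mul_add_one_mul_centralBinom_mul_pow_sq_le_one (k : ℕ) {q : ℝ}
    (hq : q ∈ Set.Icc (0 : ℝ) 1) :
    (2 * k + 1) * ((k.centralBinom : ℝ) * q ^ k * (1 - q) ^ k) ^ 2 ≤ 1 := by
  have hA : (2 * k + 1) * (k.centralBinom : ℝ) ^ 2 ≤ 16 ^ k :=
    mod_cast two_mul_add_one_mul_centralBinom_sq_le k
  have hx : 0 ≤ q * (1 - q) := mul_nonneg hq.1 (sub_nonneg.2 hq.2)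
  have hx' : q * (1 - q) ≤ 1 / 4 := by nlinarith [sq_nonneg (2 * q - 1)]
  calc (2 * k + 1) * ((k.centralBinom : ℝ) * q ^ k * (1 - q) ^ k) ^ 2
      = (2 * k + 1) * (k.centralBinom : ℝ) ^ 2 * ((q * (1 - q)) ^ k) ^ 2 := by
        rw [mul_pow q]; ring
    _ ≤ 16 ^ k * ((1 / 4) ^ k) ^ 2 := by gcongr
    _ = 1 := by
      rw [← pow_mul, mul_comm k 2, pow_mul, ← mul_pow]
      norm_num

theorem choose_two_mul_add_one_le_two_mul_centralBinom (k : ℕ) :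
    (2 * k + 1).choose (k + 1) ≤ 2 * k.centralBinom := by
  rw [Nat.choose_succ_succ', ← Nat.centralBinom_eq_two_mul_choose, two_mul k.centralBinom]
  exact Nat.add_le_add_left (Nat.choose_le_centralBinom _ _) _

/-- The squared pivotality probability is at most `8 / n`, uniformly in `q`. -/
theorem mul_pivotality_sq_le {n : ℕ} (hn : 0 < n) {q : ℝ} (hq : q ∈ Set.Icc (0 : ℝ) 1) :
    (n : ℝ) * (((n - 1).choose (n / 2) : ℝ) * q ^ (n / 2) *
      (1 - q) ^ ((n + 1) / 2 - 1)) ^ 2 ≤ 8 := by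
  obtain ⟨k, rfl | rfl⟩ : ∃ k, n = 2 * k + 1 ∨ n = 2 * k + 2 := ⟨(n - 1) / 2, by omega⟩
  · have h := two_mul_add_one_mul_centralBinom_mul_pow_sq_le_one k hq
    rw [show 2 * k + 1 - 1 = 2 * k by omega, show (2 * k + 1) / 2 = k by omega,
      show (2 * k + 1 + 1) / 2 - 1 = k by omega, ← Nat.centralBinom_eq_two_mul_choose]
    push_cast
    linarith
  · have h := two_mul_add_one_mul_centralBinom_mul_pow_sq_le_one k hq
    rw [show 2 * k + 2 - 1 = 2 * k + 1 by omega, show (2 * k + 2) / 2 = k + 1 by omega,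
      show (2 * k + 2 + 1) / 2 - 1 = k by omega]
    have hB : ((2 * k + 1).choose (k + 1) : ℝ) ≤ 2 * k.centralBinom :=
      mod_cast choose_two_mul_add_one_le_two_mul_centralBinom k
    have hq0 : 0 ≤ q := hq.1
    have hq1 : 0 ≤ 1 - q := sub_nonneg.2 hq.2
    have hpow : q ^ (k + 1) ≤ q ^ k := pow_le_pow_of_le_one hq0 hq.2 (Nat.le_succ k)
    calc ((2 * k + 2 : ℕ) : ℝ) *
          (((2 * k + 1).choose (k + 1) : ℝ) * q ^ (k + 1) * (1 - q) ^ k) ^ 2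
        ≤ (2 * (2 * k + 1)) * (2 * k.centralBinom * q ^ k * (1 - q) ^ k) ^ 2 := by
          gcongr
          push_cast
          linarith [k.cast_nonneg (α := ℝ)]
      _ = 8 * ((2 * k + 1) * ((k.centralBinom : ℝ) * q ^ k * (1 - q) ^ k) ^ 2) := by ring
      _ ≤ 8 := by linarith

/-- There is a constant `C > 0` such that for every effort cost
`c ∈ (0,1]`, every number of auditors `n ≥ C/c²`, and every approval
probability `q ∈ [0,1]`, the expected net utility gain from scrutiny
`2·p_piv(n,q) − c` is strictly negative; i.e. rubber-stamp approval strictly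
dominates careful scrutiny once `n` exceeds a threshold of order `c⁻²`. -/
theorem free_riding_dominates
    : ∃ C : ℝ, 0 < C ∧ ∀ c : ℝ, 0 < c → c ≤ 1 → ∀ n : ℕ, C / c ^ 2 ≤ (n : ℝ) →
      ∀ q ∈ Set.Icc (0 : ℝ) 1,
        2 * (((n - 1).choose (n / 2) : ℝ) * q ^ (n / 2) *
            (1 - q) ^ ((n + 1) / 2 - 1)) - c < 0 := by
  refine ⟨33, by norm_num, fun c hc _ n hn q hq => ?_⟩
  have hn0 : (0 : ℝ) < n := lt_of_lt_of_le (by positivity) hn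
  have hp := mul_pivotality_sq_le (Nat.cast_pos.1 hn0) hq
  set p : ℝ := ((n - 1).choose (n / 2) : ℝ) * q ^ (n / 2) * (1 - q) ^ ((n + 1) / 2 - 1)
  rw [div_le_iff₀ (by positivity)] at hn
  by_contra! h
  have hsq : c ^ 2 ≤ (2 * p) ^ 2 := pow_le_pow_left₀ hc.le (by linarith) 2
  have := mul_le_mul_of_nonneg_left hsq hn0.le
  linarith
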